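/- (Ax–Sen approximation) Let K be a complete discrete valuation field of mixed characteristic (0,p) with valuation v_p normalized by v_p(p)=1, let L/K be a Galois extension, and let x be an element of the completion of L such that v_p((g-1)(x)) ≥ n for all g ∈ Gal(L/K), for some integer n. Then there exists y ∈ K with v_p(x - y) ≥ n - p/(p-1)^2; in particular v_p(x-y) ≥ n - 2. -/

import Mathlib

section

open Polynomial

theorem Multiset.norm_prod_le_pow_card {E : Type*} [NormedField E] (s : Multiset E) {R : ℝ}
    (hs : ∀ r ∈ s, ‖r‖ ≤ R) : ‖s.prod‖ ≤ R ^ s.card := by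
  induction s using Multiset.induction_on with
  | empty => simp
  | cons a s ih =>
    rw [Multiset.prod_cons, Multiset.card_cons, pow_succ', norm_mul]
    have ha := hs a (Multiset.mem_cons_self a s)
    exact mul_le_mul ha (ih fun r hr ↦ hs r (Multiset.mem_cons_of_mem hr)) (norm_nonneg _)
      ((norm_nonneg _).trans ha)

theorem Multiset.pow_card_lt_norm_prod {E : Type*} [NormedField E] {s : Multiset E} (h0 : s ≠ 0)
    {S : ℝ} (hS : 0 ≤ S) (hs : ∀ r ∈ s, S < ‖r‖) : S ^ s.card < ‖s.prod‖ := by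
  induction s using Multiset.induction_on with
  | empty => exact absurd rfl h0
  | cons a s ih =>
    rw [Multiset.prod_cons, Multiset.card_cons, pow_succ', norm_mul]
    have ha := hs a (Multiset.mem_cons_self a s)
    rcases eq_or_ne s 0 with rfl | hne
    · simpa using ha
    · exact mul_lt_mul'' ha (ih hne fun r hr ↦ hs r (Multiset.mem_cons_of_mem hr)) hS
        (pow_nonneg hS _)

theorem Polynomial.norm_coeff_prod_X_sub_C_le {E : Type*} [NormedField E] [IsUltrametricDist E]
    (s : Multiset E) {R : ℝ} (hs : ∀ r ∈ s, ‖r‖ ≤ R) {k : ℕ} (hk : k ≤ s.card) :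
    ‖(s.map fun r ↦ X - C r).prod.coeff k‖ ≤ R ^ (s.card - k) := by
  rw [Multiset.prod_X_sub_C_coeff s hk, norm_mul, norm_pow, norm_neg, norm_one, one_pow, one_mul,
    Multiset.esymm]
  obtain ⟨t, ht, hle⟩ := IsUltrametricDist.exists_norm_multiset_sum_le
    (s.powersetCard (s.card - k)) (f := Multiset.prod)
  refine hle.trans ?_
  have hne : s.powersetCard (s.card - k) ≠ 0 := by
    rw [← Multiset.card_pos, Multiset.card_powersetCard]
    exact Nat.choose_pos (Nat.sub_le _ _)
  obtain ⟨hts, hcard⟩ := Multiset.mem_powersetCard.1 (ht hne)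
  rw [← hcard]
  exact t.norm_prod_le_pow_card fun r hr ↦ hs r (Multiset.mem_of_le hts hr)

theorem Polynomial.exists_root_hasseDeriv_norm_sub_le {E : Type*} [NormedField E]
    [IsUltrametricDist E] [IsAlgClosed E] [CharZero E] {f : E[X]} (hf : f.Monic) {α : E}
    {R S : ℝ} (hS : 0 ≤ S) (hroots : ∀ r ∈ f.roots, ‖r - α‖ ≤ R) {q : ℕ}
    (hq : q < f.natDegree)
    (hRS : R ^ (f.natDegree - q) ≤ ‖(f.natDegree.choose q : E)‖ * S ^ (f.natDegree - q)) :
    ∃ β, (hasseDeriv q f).IsRoot β ∧ ‖α - β‖ ≤ S := by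
  set n := f.natDegree with hn
  set h := hasseDeriv q f with hh
  have hc0 : (n.choose q : E) ≠ 0 := by exact_mod_cast (Nat.choose_pos hq.le).ne'
  have hdeg : h.natDegree = n - q := natDegree_hasseDeriv f q
  have hlead : h.leadingCoeff = n.choose q := by
    rw [leadingCoeff, hdeg, hh, hasseDeriv_coeff, Nat.sub_add_cancel hq.le, hn, hf.coeff_natDegree,
      mul_one]
  have hfeq : taylor α f = ((f.roots.map fun r ↦ r - α).map fun r ↦ X - C r).prod := by
    conv_lhs => rw [(IsAlgClosed.splits f).eq_prod_roots_of_monic hf]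
    rw [taylor_apply, multiset_prod_comp, Multiset.map_map, Multiset.map_map]
    congr 1
    refine Multiset.map_congr rfl fun r _ ↦ ?_
    simp only [Function.comp_apply, sub_comp, X_comp, C_comp, C_sub]
    ring
  have hcard : (f.roots.map fun r ↦ r - α).card = n := by
    rw [Multiset.card_map, hn, (IsAlgClosed.splits f).natDegree_eq_card_roots]
  have hup : ‖h.eval α‖ ≤ R ^ (n - q) := by
    rw [hh, ← taylor_coeff, hfeq, ← hcard]
    refine norm_coeff_prod_X_sub_C_le _ ?_ (hcard ▸ hq.le)
    intro r hr
    obtain ⟨s, hs, rfl⟩ := Multiset.mem_map.1 hr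
    exact hroots s hs
  by_contra! hcon
  have hhcard : (h.roots.map fun r ↦ α - r).card = n - q := by
    rw [Multiset.card_map, ← hdeg, (IsAlgClosed.splits h).natDegree_eq_card_roots]
  have heval : h.eval α = n.choose q * (h.roots.map fun r ↦ α - r).prod := by
    conv_lhs => rw [(IsAlgClosed.splits h).eq_prod_roots]
    rw [hlead, eval_mul, eval_C, eval_multiset_prod, Multiset.map_map]
    simp
  have hlt := Multiset.pow_card_lt_norm_prod (s := h.roots.map fun r ↦ α - r)
    (by rw [← Multiset.card_pos, hhcard]; omega) hS (by
      intro r hr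
      obtain ⟨s, hs, rfl⟩ := Multiset.mem_map.1 hr
      exact hcon s (isRoot_of_mem_roots hs))
  rw [heval, norm_mul] at hup
  rw [hhcard] at hlt
  exact (hup.trans hRS).not_gt (mul_lt_mul_of_pos_left hlt (norm_pos_iff.2 hc0))

theorem Nat.not_dvd_choose_mul_prime_pow {p m : ℕ} [Fact p.Prime] (hm : ¬ p ∣ m) (k : ℕ) :
    ¬ p ∣ (p ^ k * m).choose (p ^ k) := by
  induction k with
  | zero => simpa using hm
  | succ k ih =>
    have hp := (Fact.out : p.Prime).pos
    have h := Choose.choose_modEq_choose_mod_mul_choose_div_nat (n := p ^ (k + 1) * m)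
      (k := p ^ (k + 1)) (p := p)
    rw [pow_succ', mul_assoc, Nat.mul_mod_right, Nat.mul_mod_right, Nat.mul_div_cancel_left _ hp,
      Nat.mul_div_cancel_left _ hp, Nat.choose_self, one_mul] at h
    rw [pow_succ', mul_assoc, Nat.modEq_zero_iff_dvd.symm.not]
    exact fun h' ↦ ih (Nat.modEq_zero_iff_dvd.1 (h.symm.trans h'))

theorem norm_natCast_eq_one_of_not_dvd {E : Type*} [NormedField E] [IsUltrametricDist E] {p : ℕ}
    [Fact p.Prime] (hp : ‖(p : E)‖ < 1) {c : ℕ} (hc : ¬ p ∣ c) : ‖(c : E)‖ = 1 := by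
  refine le_antisymm (IsUltrametricDist.norm_natCast_le_one E c) ?_
  by_contra! hlt
  have hco : IsCoprime (c : ℤ) (p : ℤ) :=
    Nat.isCoprime_iff_coprime.2 (((Fact.out : p.Prime).coprime_iff_not_dvd.2 hc).symm)
  obtain ⟨a, b, hab⟩ := hco
  have hab' : (a : E) * c + b * p = 1 := by exact_mod_cast congrArg (Int.cast : ℤ → E) hab
  have h1 : ‖(a : E) * c‖ < 1 := by
    rw [norm_mul]
    exact mul_lt_one_of_nonneg_of_lt_one_right (IsUltrametricDist.norm_intCast_le_one E a)
      (norm_nonneg _) hlt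
  have h2 : ‖(b : E) * p‖ < 1 := by
    rw [norm_mul]
    exact mul_lt_one_of_nonneg_of_lt_one_right (IsUltrametricDist.norm_intCast_le_one E b)
      (norm_nonneg _) hp
  have h3 := (IsUltrametricDist.norm_add_le_max ((a : E) * c) (b * p)).trans_lt (max_lt h1 h2)
  rw [hab', norm_one] at h3
  exact lt_irrefl _ h3

theorem norm_choose_prime_pow_succ {E : Type*} [NormedField E] [IsUltrametricDist E] {p : ℕ}
    [hp : Fact p.Prime] (hlt : ‖(p : E)‖ < 1) (k : ℕ) :
    ‖((p ^ (k + 1)).choose (p ^ k) : E)‖ = ‖(p : E)‖ := by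
  have hpos : (p ^ (k + 1)).choose (p ^ k) ≠ 0 :=
    (Nat.choose_pos (Nat.pow_le_pow_right hp.out.pos k.le_succ)).ne'
  have hfac : ((p ^ (k + 1)).choose (p ^ k)).factorization p = 1 := by
    rw [Nat.factorization_choose_prime_pow hp.out
      (Nat.pow_le_pow_right hp.out.pos k.le_succ) (pow_ne_zero _ hp.out.ne_zero),
      hp.out.factorization_pow]
    simp
  have h1 := norm_natCast_eq_one_of_not_dvd hlt (Nat.not_dvd_ordCompl hp.out hpos)
  conv_lhs => rw [← Nat.ordProj_mul_ordCompl_eq_self ((p ^ (k + 1)).choose (p ^ k)) p]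
  rw [Nat.cast_mul, norm_mul, h1, mul_one, hfac, pow_one]

theorem exists_natDegree_minpoly_lt_norm_sub_le {K E : Type*} [Field K] [NormedField E]
    [IsUltrametricDist E] [IsAlgClosed E] [CharZero E] [Algebra K E]
    [Algebra.IsAlgebraic K E] {α : E} {R S : ℝ} (hS : 0 ≤ S)
    (hα : ∀ σ : E ≃ₐ[K] E, ‖σ α - α‖ ≤ R) {q : ℕ} (hq0 : 0 < q)
    (hq : q < (minpoly K α).natDegree)
    (hRS : R ^ ((minpoly K α).natDegree - q) ≤
      ‖((minpoly K α).natDegree.choose q : E)‖ * S ^ ((minpoly K α).natDegree - q)) :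
    ∃ β : E, (minpoly K β).natDegree < (minpoly K α).natDegree ∧ ‖α - β‖ ≤ S := by
  have : CharZero K := (algebraMap K E).charZero_iff (algebraMap K E).injective |>.2 inferInstance
  have : IsAlgClosure K E := ⟨inferInstance, inferInstance⟩
  have hint : IsIntegral K α := Algebra.IsIntegral.isIntegral α
  have hmonic := minpoly.monic hint
  have hroots : ∀ r ∈ ((minpoly K α).map (algebraMap K E)).roots, ‖r - α‖ ≤ R := by
    intro r hr
    have hr' : aeval r (minpoly K α) = 0 := by
      rw [aeval_def, ← eval_map]
      exact isRoot_of_mem_roots hr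
    obtain ⟨σ, rfl⟩ := ((isConjRoot_iff_aeval_eq_zero hint).2 hr').symm.exists_algEquiv
    exact hα σ
  obtain ⟨β, hβ, hle⟩ := exists_root_hasseDeriv_norm_sub_le (hmonic.map (algebraMap K E)) hS hroots
    (q := q) (by rwa [natDegree_map]) (by rwa [natDegree_map])
  refine ⟨β, ?_, hle⟩
  have hdeg : (hasseDeriv q (minpoly K α)).natDegree = (minpoly K α).natDegree - q :=
    natDegree_hasseDeriv _ _
  have hne : hasseDeriv q (minpoly K α) ≠ 0 := by
    rintro h
    rw [h, natDegree_zero] at hdeg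
    omega
  have hmap : hasseDeriv q ((minpoly K α).map (algebraMap K E)) =
      (hasseDeriv q (minpoly K α)).map (algebraMap K E) := by
    ext i
    simp [hasseDeriv_coeff]
  have hdvd : minpoly K β ∣ hasseDeriv q (minpoly K α) := by
    refine minpoly.dvd K β ?_
    rw [aeval_def, ← eval_map, ← hmap]
    exact hβ
  have := natDegree_le_of_dvd hdvd hne
  omega

/-- The exponent in Ax's estimate for elements whose degree is less than `p ^ (d + 1)`; it is the
partial sum `∑ i < d, 1 / (p ^ (i + 1) - p ^ i)`. -/
noncomputable def axExponent (p d : ℕ) : ℝ :=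
  p / ((p : ℝ) - 1) ^ 2 * (1 - ((p : ℝ) ^ d)⁻¹)

theorem axExponent_succ {p : ℕ} (hp : 1 < p) (d : ℕ) :
    axExponent p (d + 1) = axExponent p d + ((p ^ (d + 1) - p ^ d : ℕ) : ℝ)⁻¹ := by
  have hp' : (1 : ℝ) < p := by exact_mod_cast hp
  have h0 : (p : ℝ) ≠ 0 := by positivity
  have h1 : (p : ℝ) - 1 ≠ 0 := by linarith
  rw [Nat.cast_sub (Nat.pow_le_pow_right hp.le d.le_succ), Nat.cast_pow, Nat.cast_pow, axExponent,
    axExponent, show (p : ℝ) ^ (d + 1) - p ^ d = p ^ d * (p - 1) by ring]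
  field_simp
  ring

theorem axExponent_mono {p : ℕ} (hp : 1 < p) : Monotone (axExponent p) :=
  monotone_nat_of_le_succ fun d ↦ by
    rw [axExponent_succ hp]
    exact le_add_of_nonneg_right (by positivity)

theorem axExponent_nonneg {p : ℕ} (hp : 1 < p) (d : ℕ) : 0 ≤ axExponent p d := by
  simpa [axExponent] using axExponent_mono hp (Nat.zero_le d)

theorem axExponent_le (p d : ℕ) : axExponent p d ≤ p / ((p : ℝ) - 1) ^ 2 :=
  mul_le_of_le_one_right (by positivity) (sub_le_self _ (by positivity))

theorem exists_norm_sub_algebraMap_le_axExponent {p : ℕ} [hp : Fact p.Prime] {K E : Type*}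
    [Field K] [NormedField E] [IsUltrametricDist E] [IsAlgClosed E] [CharZero E] [Algebra K E]
    [Algebra.IsAlgebraic K E] (hpE : ‖(p : E)‖ = (p : ℝ)⁻¹)
    (hiso : ∀ (σ : E ≃ₐ[K] E) (x : E), ‖σ x‖ = ‖x‖) {α : E} {R : ℝ}
    (hα : ∀ σ : E ≃ₐ[K] E, ‖σ α - α‖ ≤ R) :
    ∃ y : K, ‖α - algebraMap K E y‖ ≤
      R * (p : ℝ) ^ axExponent p (Nat.log p (minpoly K α).natDegree) := by
  have hp1 : (1 : ℝ) < p := by exact_mod_cast hp.out.one_lt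
  have hp0 : (0 : ℝ) < p := by linarith
  have hlt : ‖(p : E)‖ < 1 := hpE ▸ inv_lt_one_of_one_lt₀ hp1
  induction hn : (minpoly K α).natDegree using Nat.strong_induction_on generalizing α R with
  | _ n ih =>
  have hR : 0 ≤ R := (norm_nonneg _).trans (hα AlgEquiv.refl)
  have hn0 : 0 < n := hn ▸ minpoly.natDegree_pos (Algebra.IsIntegral.isIntegral α)
  have hge : R ≤ R * (p : ℝ) ^ axExponent p (Nat.log p n) :=
    le_mul_of_one_le_right hR
      (Real.one_le_rpow hp1.le (axExponent_nonneg hp.out.one_lt _))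
  have descend (S : ℝ) (hRS : R ≤ S) (β : E) (hdeg : (minpoly K β).natDegree < n)
      (hβ : ‖α - β‖ ≤ S)
      (hS : S * (p : ℝ) ^ axExponent p (Nat.log p (minpoly K β).natDegree) ≤
        R * (p : ℝ) ^ axExponent p (Nat.log p n)) :
      ∃ y : K, ‖α - algebraMap K E y‖ ≤ R * (p : ℝ) ^ axExponent p (Nat.log p n) := by
    have hβ' (σ : E ≃ₐ[K] E) : ‖σ β - β‖ ≤ S := by
      have h : σ β - β = σ (β - α) + ((σ α - α) + (α - β)) := by
        rw [map_sub]
        ring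
      rw [h]
      refine (IsUltrametricDist.norm_add_le_max _ _).trans (max_le ?_
        ((IsUltrametricDist.norm_add_le_max _ _).trans (max_le ((hα σ).trans hRS) hβ)))
      rwa [hiso, norm_sub_rev]
    obtain ⟨y, hy⟩ := ih _ hdeg hβ' rfl
    have hSle : S ≤ S * (p : ℝ) ^ axExponent p (Nat.log p (minpoly K β).natDegree) :=
      le_mul_of_one_le_right (hR.trans hRS)
        (Real.one_le_rpow hp1.le (axExponent_nonneg hp.out.one_lt _))
    refine ⟨y, ?_⟩
    rw [← sub_add_sub_cancel α β]
    exact (IsUltrametricDist.norm_add_le_max _ _).trans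
      (max_le (hβ.trans (hSle.trans hS)) (hy.trans hS))
  obtain ⟨k, m, hm, hnkm⟩ := Nat.exists_eq_pow_mul_and_not_dvd hn0.ne' p hp.out.ne_one
  have hpk : 0 < p ^ k := pow_pos hp.out.pos k
  rcases Nat.lt_or_ge 1 m with hm1 | hm1
  · obtain ⟨β, hdeg, hβ⟩ := exists_natDegree_minpoly_lt_norm_sub_le hR hα hpk
      (by rw [hn, hnkm]; exact lt_mul_of_one_lt_right hpk hm1)
      (by rw [hn, hnkm, norm_natCast_eq_one_of_not_dvd hlt (Nat.not_dvd_choose_mul_prime_pow hm k),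
        one_mul])
    rw [hn] at hdeg
    refine descend R le_rfl β hdeg hβ (mul_le_mul_of_nonneg_left ?_ hR)
    exact Real.rpow_le_rpow_of_exponent_le hp1.le
      (axExponent_mono hp.out.one_lt (Nat.log_mono_right hdeg.le))
  obtain rfl : m = 1 := by
    have : m ≠ 0 := by rintro rfl; simp at hm
    omega
  rw [mul_one] at hnkm
  cases k with
  | zero =>
    obtain ⟨y, hy⟩ := minpoly.natDegree_eq_one_iff.1 (hn.trans hnkm)
    exact ⟨y, by rw [hy, sub_self, norm_zero]; exact hR.trans hge⟩
  | succ k =>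
    have hqn : p ^ k < p ^ (k + 1) := Nat.pow_lt_pow_right hp.out.one_lt k.lt_succ_self
    set e := p ^ (k + 1) - p ^ k with he
    have he0 : (e : ℝ) ≠ 0 := by
      have : e ≠ 0 := by omega
      exact_mod_cast this
    obtain ⟨β, hdeg, hβ⟩ := exists_natDegree_minpoly_lt_norm_sub_le
      (S := R * (p : ℝ) ^ (e : ℝ)⁻¹) (q := p ^ k) (by positivity) hα (pow_pos hp.out.pos k)
      (by rw [hn, hnkm]; exact hqn)
      (by
        rw [hn, hnkm, norm_choose_prime_pow_succ hlt, hpE, ← he, mul_pow,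
          ← Real.rpow_natCast ((p : ℝ) ^ (e : ℝ)⁻¹), ← Real.rpow_mul hp0.le, inv_mul_cancel₀ he0,
          Real.rpow_one]
        field_simp
        exact le_rfl)
    rw [hn] at hdeg
    have hlog : Nat.log p (minpoly K β).natDegree ≤ k := by
      refine Nat.lt_succ_iff.1 (Nat.log_lt_of_lt_pow ?_ (hnkm ▸ hdeg))
      exact (minpoly.natDegree_pos (Algebra.IsIntegral.isIntegral β)).ne'
    refine descend _ (le_mul_of_one_le_right hR (Real.one_le_rpow hp1.le (by positivity))) β hdeg hβ
      ?_
    rw [mul_assoc, ← Real.rpow_add hp0, hnkm, Nat.log_pow hp.out.one_lt,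
      axExponent_succ hp.out.one_lt, add_comm]
    refine mul_le_mul_of_nonneg_left (Real.rpow_le_rpow_of_exponent_le hp1.le ?_) hR
    exact add_le_add_left (axExponent_mono hp.out.one_lt hlog) _

theorem exists_norm_sub_algebraMap_le_of_normal {p : ℕ} [hp : Fact p.Prime] {K L : Type*}
    [NontriviallyNormedField K] [CompleteSpace K] [IsUltrametricDist K] [CharZero K]
    [NormedField L] [NormedAlgebra K L] [Normal K L] (hpK : ‖(p : K)‖ = (p : ℝ)⁻¹) {a : L} {R : ℝ}
    (ha : ∀ σ : L ≃ₐ[K] L, ‖σ a - a‖ ≤ R) :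
    ∃ y : K, ‖a - algebraMap K L y‖ ≤ R * (p : ℝ) ^ ((p : ℝ) / ((p : ℝ) - 1) ^ 2) := by
  have : Algebra.IsAlgebraic K L := Normal.toIsAlgebraic
  have : Algebra.IsAlgebraic K (AlgebraicClosure L) := Algebra.IsAlgebraic.trans K L _
  let : NormedField (AlgebraicClosure L) := spectralNorm.normedField K (AlgebraicClosure L)
  have hnorm (z : AlgebraicClosure L) : ‖z‖ = spectralNorm K (AlgebraicClosure L) z := rfl
  have : IsUltrametricDist (AlgebraicClosure L) :=
    IsUltrametricDist.isUltrametricDist_of_isNonarchimedean_norm isNonarchimedean_spectralNorm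
  have : CharZero (AlgebraicClosure L) :=
    charZero_of_injective_algebraMap (algebraMap K (AlgebraicClosure L)).injective
  have hval (z : L) : ‖algebraMap L (AlgebraicClosure L) z‖ = ‖z‖ := by
    rw [hnorm, NormedAlgebra.norm_eq_spectralNorm K z, spectralNorm, spectralNorm,
      minpoly.algebraMap_eq (algebraMap L (AlgebraicClosure L)).injective]
  have hpE : ‖(p : AlgebraicClosure L)‖ = (p : ℝ)⁻¹ := by
    rw [← map_natCast (algebraMap K (AlgebraicClosure L)), hnorm, spectralNorm_extends, hpK]
  obtain ⟨y, hy⟩ := exists_norm_sub_algebraMap_le_axExponent (K := K) hpE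
    (fun σ z ↦ (spectralNorm_eq_of_equiv σ z).symm)
    (α := algebraMap L (AlgebraicClosure L) a) (R := R) (fun τ ↦ by
      rw [← AlgEquiv.restrictNormal_commutes, ← map_sub, hval]
      exact ha _)
  refine ⟨y, ?_⟩
  rw [IsScalarTower.algebraMap_apply K L (AlgebraicClosure L), ← map_sub, hval] at hy
  refine hy.trans (mul_le_mul_of_nonneg_left ?_ ((norm_nonneg _).trans (ha AlgEquiv.refl)))
  exact Real.rpow_le_rpow_of_exponent_le (by exact_mod_cast hp.out.one_lt.le) (axExponent_le _ _)

theorem IntermediateField.exists_isometry_extending_algEquiv {K F : Type*} [Field K] [NormedField F]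
    [CompleteSpace F] [Algebra K F] {L : IntermediateField K F} (hL : Dense (L : Set F))
    (σ : L ≃ₐ[K] L) (hσ : ∀ a, ‖σ a‖ = ‖a‖) :
    ∃ g : F ≃ₐ[K] F, Isometry g ∧ ∀ a : L, g a = σ a := by
  have hi : IsUniformInducing (L.val : L →+* F) := isometry_subtype_coe.isUniformInducing
  have hd : DenseRange (L.val : L →+* F) := hL.denseRange_val
  let f : L →+* F := (L.val : L →+* F).comp (σ : L →+* L)
  have hf : UniformContinuous f :=
    (AddMonoidHomClass.isometry_of_norm f hσ).uniformContinuous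
  let g : F →+* F := IsDenseInducing.extendRingHom hi hd hf
  have hgc : Continuous g := (uniformContinuous_uniformly_extend hi hd hf).continuous
  have hgL (a : L) : g a = σ a := IsDenseInducing.extend_eq (hi.isDenseInducing hd) hf.continuous a
  have hgi : Isometry g := by
    refine AddMonoidHomClass.isometry_of_norm g fun z ↦ ?_
    refine hd.induction_on z (isClosed_eq hgc.norm continuous_norm) fun a ↦ ?_
    exact (congrArg norm (hgL a)).trans (hσ a)
  have hsurj : Function.Surjective g := by
    have hclosed : IsClosed (Set.range g) := hgi.isClosedEmbedding.isClosed_range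
    have hsub : (L : Set F) ⊆ Set.range g := fun a ha ↦
      ⟨σ.symm ⟨a, ha⟩, by rw [hgL, AlgEquiv.apply_symm_apply]⟩
    intro z
    exact hclosed.closure_subset_iff.2 hsub (hL z)
  let gK : F →ₐ[K] F :=
    { g with
      commutes' := fun k ↦ by
        have h := hgL (algebraMap K L k)
        rwa [AlgEquiv.commutes] at h }
  exact ⟨AlgEquiv.ofBijective gK ⟨hgi.injective, hsurj⟩, hgi, hgL⟩

end

/-- Ax–Sen approximation: `K` a complete discrete valuation field of mixed
characteristic `(0,p)` (realized as a closed, discretely valued subfield of a complete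
ultrametric field `F` with `‖p‖ = p⁻¹`), `L/K` a Galois extension with `F` the completion
of `L` (i.e. `L` dense in `F`). If `x ∈ F` satisfies `‖g x - x‖ ≤ p^{-n}` for every
(isometric, `L`-preserving) element `g` of `Gal(L/K)` acting on the completion, then
there is `y ∈ K` with `v_p(x - y) ≥ n - p/(p-1)²`; in particular `v_p(x - y) ≥ n - 2`. -/
theorem stmt_5 (p : ℕ) [Fact p.Prime]
    (F : Type*) [NormedField F] [CompleteSpace F] [IsUltrametricDist F] [CharZero F]
    (hp : ‖(p : F)‖ = (p : ℝ)⁻¹)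
    (K : Subfield F) (hKclosed : IsClosed (K : Set F))
    (hKdisc : ∃ π ∈ K, 0 < ‖π‖ ∧ ‖π‖ < 1 ∧
      ∀ z ∈ K, z ≠ 0 → ∃ k : ℤ, ‖z‖ = ‖π‖ ^ k)
    (L : IntermediateField K F) (hLgal : IsGalois K L) (hLdense : Dense (L : Set F))
    (x : F) (n : ℤ)
    (hx : ∀ g : F ≃ₐ[K] F, Isometry g → (∀ a ∈ L, g a ∈ L) →
      ‖g x - x‖ ≤ (p : ℝ) ^ (-n)) :
    ∃ y ∈ K, ‖x - y‖ ≤ (p : ℝ) ^ ((p : ℝ) / ((p : ℝ) - 1) ^ 2 - (n : ℝ)) ∧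
      ‖x - y‖ ≤ (p : ℝ) ^ ((2 : ℝ) - (n : ℝ)) := by
  have hprime := (Fact.out : p.Prime)
  have hp1 : (1 : ℝ) < p := by exact_mod_cast hprime.one_lt
  have hp0 : (0 : ℝ) < p := by linarith
  obtain ⟨π, hπK, hπ0, hπ1, -⟩ := hKdisc
  let : NontriviallyNormedField K :=
    { SubfieldClass.toNormedField K with
      non_trivial := ⟨⟨π⁻¹, K.inv_mem hπK⟩, by
        change 1 < ‖π⁻¹‖
        rw [norm_inv]
        exact (one_lt_inv₀ hπ0).2 hπ1⟩ }
  have : CompleteSpace K := hKclosed.completeSpace_coe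
  let : NormedAlgebra K F := { (inferInstance : Algebra K F) with
    norm_smul_le := fun k z ↦ (norm_mul (k : F) z).le }
  let : NormedAlgebra K L := { (inferInstance : Algebra K L) with
    norm_smul_le := fun k z ↦ (norm_mul (k : F) z).le }
  have : Normal K L := hLgal.to_normal
  have : Algebra.IsAlgebraic K L := Normal.toIsAlgebraic
  have hext (σ : L ≃ₐ[K] L) := L.exists_isometry_extending_algEquiv hLdense σ fun a ↦ by
    rw [NormedAlgebra.norm_eq_spectralNorm K (σ a), NormedAlgebra.norm_eq_spectralNorm K a,
      ← spectralNorm_eq_of_equiv]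
  have hR : (0 : ℝ) < (p : ℝ) ^ (-n) := zpow_pos hp0 _
  obtain ⟨a, hxa, haL⟩ := Metric.dense_iff.1 hLdense x _ hR
  rw [Metric.mem_ball, dist_eq_norm] at hxa
  have hconj (σ : L ≃ₐ[K] L) : ‖σ ⟨a, haL⟩ - ⟨a, haL⟩‖ ≤ (p : ℝ) ^ (-n) := by
    obtain ⟨g, hgi, hg⟩ := hext σ
    have hgx := hx g hgi fun b hb ↦ by
      rw [hg ⟨b, hb⟩]
      exact (σ ⟨b, hb⟩).2
    have hsplit : ((σ ⟨a, haL⟩ : L) : F) - a = g (a - x) + ((g x - x) + (x - a)) := by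
      rw [← hg, map_sub]
      ring
    change ‖((σ ⟨a, haL⟩ : L) : F) - a‖ ≤ _
    rw [hsplit]
    refine (IsUltrametricDist.norm_add_le_max _ _).trans (max_le ?_
      ((IsUltrametricDist.norm_add_le_max _ _).trans (max_le hgx ?_)))
    · rw [hgi.norm_map_of_map_zero (map_zero g)]
      exact hxa.le
    · rw [norm_sub_rev]
      exact hxa.le
  obtain ⟨y, hy⟩ := exists_norm_sub_algebraMap_le_of_normal (K := K) (L := L) hp hconj
  change ‖a - (y : F)‖ ≤ _ at hy
  have hexp : (p : ℝ) / ((p : ℝ) - 1) ^ 2 ≤ 2 := by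
    have hp2 : (2 : ℝ) ≤ p := by exact_mod_cast hprime.two_le
    rw [div_le_iff₀ (by nlinarith)]
    nlinarith
  have hbound : ‖x - y‖ ≤ (p : ℝ) ^ ((p : ℝ) / ((p : ℝ) - 1) ^ 2 - (n : ℝ)) := by
    rw [sub_eq_neg_add _ (n : ℝ), Real.rpow_add hp0, ← Int.cast_neg, Real.rpow_intCast,
      ← sub_add_sub_cancel x a]
    refine (IsUltrametricDist.norm_add_le_max _ _).trans (max_le ?_ hy)
    rw [norm_sub_rev]
    exact hxa.le.trans
      (le_mul_of_one_le_right hR.le (Real.one_le_rpow hp1.le (by positivity)))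
  exact ⟨y, y.2, hbound, hbound.trans
    (Real.rpow_le_rpow_of_exponent_le hp1.le (sub_le_sub_right hexp _))⟩
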